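/- arXiv:1807.03331 — 6 statements merged into one kernel-verified Lean document; each statement's English description precedes it below -/
import Mathlib

section
/- Let e'=(x,z) be an edge of T_X such that φ_z(g_x,g'_x) < φ_z(g_z,g'_z). Then one of the following two conditions is satisfied: (1) a_z, a'_z ∈ U(e',x) and {a_x, a'_x} ∩ U(e',z) ≠ ∅; or (2) a_x, a'_x ∈ U(e',z) and {a_z, a'_z} ∩ U(e',x) ≠ ∅. -/
open SimpleGraph

variable {V : Type*} [Fintype V] [DecidableEq V]

/-- The vertex set of the connected component of `w` in the graph obtained from `T` by
removing the edge `s(u, v)`. -/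
def sideOf (T : SimpleGraph V) (u v w : V) : Set V :=
  {t | (T.deleteEdges {s(u, v)}).Reachable w t}

/-- The swap edges of the tree edge `(u, v)`: all edges of `G` other than `s(u, v)` whose
first endpoint lies in the component `X` of `u` and whose second endpoint lies in the
component `Y` of `v` of `T - e`. -/
def swapSet (G T : SimpleGraph V) (u v : V) : Set (V × V) :=
  {p | G.Adj p.1 p.2 ∧ s(p.1, p.2) ≠ s(u, v) ∧
        p.1 ∈ sideOf T u v u ∧ p.2 ∈ sideOf T u v v}

/-- `φ_w(g, g') = d_T(w, a) + d_T(b, b') + d_T(a', w)` for `g = (a, b)` and `g' = (a', b')`. -/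
noncomputable def phi (T : SimpleGraph V) (w : V) (g g' : V × V) : ℕ :=
  T.dist w g.1 + T.dist g.2 g'.2 + T.dist g'.1 w

/-- For an edge `e' = (x, z)` of the subtree `T_X` of `T` induced by the vertex set `X`,
`Uside T X x z` is the set `U(e', x)`: the vertices of `X` lying in the connected component
of `x` of `T_X - e'` (equivalently, of `T` minus the edge `s(x, z)`).  The set `U(e', z)`
is `Uside T X z x`. -/
def Uside (T : SimpleGraph V) (X : Set V) (x z : V) : Set V :=
  {t ∈ X | (T.deleteEdges {s(x, z)}).Reachable x t}

/-- If `t` is strictly closer to `x` than to `z`, then `t` stays connected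
to `x` after removing the edge `s(x, z)`. -/
theorem reachable_deleteEdges_of_dist_lt {T : SimpleGraph V} (hT : T.Connected) {x z t : V}
    (h : T.dist t x < T.dist t z) : (T.deleteEdges {s(x, z)}).Reachable x t := by
  obtain ⟨p, hp⟩ := hT.exists_walk_length_eq_dist t x
  refine Reachable.symm ⟨p.toDeleteEdge s(x, z) fun hmem => ?_⟩
  have hz := p.snd_mem_support_of_mem_edges hmem
  have h1 := dist_le (p.takeUntil z hz)
  have h2 := p.length_takeUntil_le_length hz
  omega

/-- Every vertex of `X` lies on the side of that endpoint of the tree edge `s(x, z)` that is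
closer to it, and the two distances differ by exactly one. -/
theorem mem_Uside_or_mem_Uside {T : SimpleGraph V} (hT : T.IsTree) {X : Set V} {x z t : V}
    (hxz : T.Adj x z) (ht : t ∈ X) :
    (t ∈ Uside T X x z ∧ T.dist z t = T.dist x t + 1) ∨
      (t ∈ Uside T X z x ∧ T.dist x t = T.dist z t + 1) := by
  rw [T.dist_comm (u := z), T.dist_comm (u := x)]
  rcases hT.dist_eq_dist_add_one_of_adj t hxz with h | h
  · exact Or.inr ⟨⟨ht, reachable_deleteEdges_of_dist_lt hT.connected (by omega)⟩, h⟩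
  · exact Or.inl ⟨⟨ht, reachable_deleteEdges_of_dist_lt hT.connected (by omega)⟩, h⟩

/-- If `e' = (x, z)` is an edge of `T_X` with `φ_z(g_x, g'_x) < φ_z(g_z, g'_z)`, then either
`a_z, a'_z ∈ U(e', x)` and `{a_x, a'_x} ∩ U(e', z) ≠ ∅`, or
`a_x, a'_x ∈ U(e', z)` and `{a_z, a'_z} ∩ U(e', x) ≠ ∅`. -/
theorem useful_lemma
    (G T : SimpleGraph V) (hTG : T ≤ G) (hT : T.IsTree)
    (hGconn : G.Connected) (h2ec : ∀ f ∈ G.edgeSet, (G.deleteEdges {f}).Connected)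
    (u v : V) (he : T.Adj u v)
    (gp : V → (V × V) × (V × V))
    (hgp : ∀ w ∈ sideOf T u v u,
      (gp w).1 ∈ swapSet G T u v ∧ (gp w).2 ∈ swapSet G T u v ∧
        ∀ g ∈ swapSet G T u v, ∀ g' ∈ swapSet G T u v,
          phi T w g g' ≤ phi T w (gp w).1 (gp w).2)
    (x z : V) (hx : x ∈ sideOf T u v u) (hz : z ∈ sideOf T u v u) (hxz : T.Adj x z)
    (hlt : phi T z (gp x).1 (gp x).2 < phi T z (gp z).1 (gp z).2) :
    ((gp z).1.1 ∈ Uside T (sideOf T u v u) x z ∧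
      (gp z).2.1 ∈ Uside T (sideOf T u v u) x z ∧
      ((gp x).1.1 ∈ Uside T (sideOf T u v u) z x ∨
        (gp x).2.1 ∈ Uside T (sideOf T u v u) z x)) ∨
    ((gp x).1.1 ∈ Uside T (sideOf T u v u) z x ∧
      (gp x).2.1 ∈ Uside T (sideOf T u v u) z x ∧
      ((gp z).1.1 ∈ Uside T (sideOf T u v u) x z ∨
        (gp z).2.1 ∈ Uside T (sideOf T u v u) x z)) := by
  obtain ⟨hx1, hx2, -⟩ := hgp x hx
  obtain ⟨hz1, hz2, -⟩ := hgp z hz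
  have hmax := (hgp x hx).2.2 _ hz1 _ hz2
  have key := fun t (ht : t ∈ sideOf T u v u) => mem_Uside_or_mem_Uside hT hxz ht
  unfold phi at hlt hmax
  rw [T.dist_comm (v := x), T.dist_comm (v := x)] at hmax
  rw [T.dist_comm (v := z), T.dist_comm (v := z)] at hlt
  rcases key _ hx1.2.2.1 with ⟨m1, d1⟩ | ⟨m1, d1⟩ <;>
  rcases key _ hx2.2.2.1 with ⟨m2, d2⟩ | ⟨m2, d2⟩ <;>
  rcases key _ hz1.2.2.1 with ⟨m3, d3⟩ | ⟨m3, d3⟩ <;>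
  rcases key _ hz2.2.2.1 with ⟨m4, d4⟩ | ⟨m4, d4⟩ <;>
  first
    | (exfalso; omega)
    | tauto
end

section
/- There exist at most three pairs of swap edges (g^1,g'^1), (g^2,g'^2), (g^3,g'^3) ∈ S_e × S_e such that for every vertex v ∈ X, at least one of these three pairs maximizes φ_v over S_e × S_e, i.e., φ_v(g^i,g'^i) = max_{(g,g') ∈ S_e × S_e} φ_v(g,g') for some i ∈ {1,2,3}. -/
open SimpleGraph

variable {V : Type*} [Fintype V] [DecidableEq V]

namespace SimpleGraph

section TreeMetric

variable {W : Type*} {T : SimpleGraph W}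

/-- A vertex other than `a` has a neighbour one step closer to `a`. -/
lemma Connected.exists_adj_dist_eq_add_one (hT : T.Connected) {a x : W} (hne : x ≠ a) :
    ∃ z, T.Adj x z ∧ T.dist a x = T.dist a z + 1 := by
  obtain ⟨p, hp⟩ := hT.exists_walk_length_eq_dist x a
  cases p with
  | nil => exact absurd rfl hne
  | @cons _ z _ h q =>
    refine ⟨z, h, ?_⟩
    have h₁ := dist_le q
    have h₂ := hT.dist_triangle (u := x) (v := z) (w := a)
    have h₃ := dist_eq_one_iff_adj.mpr h
    rw [Walk.length_cons] at hp
    rw [dist_comm (u := a), dist_comm (u := a)]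
    omega

/-- In a tree, a vertex has at most one neighbour closer to a given root. -/
lemma IsTree.eq_of_adj_of_dist_eq_add_one (hT : T.IsTree) {y x z z' : W}
    (hz : T.Adj z x) (hz' : T.Adj z' x) (h : T.dist y x = T.dist y z + 1)
    (h' : T.dist y x = T.dist y z' + 1) : z = z' := by
  obtain ⟨p, -, hp⟩ := hT.connected.exists_path_of_dist y z
  obtain ⟨q, -, hq⟩ := hT.connected.exists_path_of_dist y z'
  have hp' : (p.concat hz).IsPath :=
    Walk.isPath_of_length_eq_dist _ (by rw [Walk.length_concat]; omega)
  have hq' : (q.concat hz').IsPath :=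
    Walk.isPath_of_length_eq_dist _ (by rw [Walk.length_concat]; omega)
  have heq : p.concat hz = q.concat hz' :=
    Subtype.mk.inj <| hT.isAcyclic.subsingleton_path y x |>.elim ⟨_, hp'⟩ ⟨_, hq'⟩
  simpa using congrArg Walk.penultimate heq

/-- In a tree, vertices on opposite sides of the edge `x z` are joined through that edge. -/
lemma IsTree.dist_eq_add_of_adj (hT : T.IsTree) {x z y a : W} (hadj : T.Adj x z)
    (hy : T.dist y x = T.dist y z + 1) (ha : T.dist a z = T.dist a x + 1) :
    T.dist y a = T.dist y x + T.dist a x := by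
  induction hn : T.dist a x generalizing x z with
  | zero =>
    have hax : a = x := hT.connected.dist_eq_zero_iff.mp hn
    simp [hax]
  | succ n ih =>
    have hne : x ≠ a := by
      rintro rfl
      simp at hn
    obtain ⟨x', hx', hd⟩ := hT.connected.exists_adj_dist_eq_add_one hne
    rcases hT.dist_eq_dist_add_one_of_adj y hx' with h | h
    · have := hT.eq_of_adj_of_dist_eq_add_one hadj.symm hx'.symm hy h
      subst this
      omega
    · rw [ih hx'.symm h hd (by omega)]
      omega

/-- Any three vertices of a tree have a median. -/
lemma IsTree.exists_median (hT : T.IsTree) (a b c : W) :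
    ∃ x, T.dist a x + T.dist b x = T.dist a b ∧ T.dist a x + T.dist c x = T.dist a c ∧
      T.dist b x + T.dist c x = T.dist b c := by
  obtain ⟨x, hx, hmin⟩ := (measure (T.dist c)).wf.has_min
    {x | T.dist a x + T.dist b x = T.dist a b} ⟨a, by simp [dist_comm]⟩
  simp only [Set.mem_ofPred_eq, InvImage, WellFoundedRelation.rel] at hx hmin
  have key : ∀ a b, T.dist a x + T.dist b x = T.dist a b →
      (∀ y, T.dist a y + T.dist b y = T.dist a b → ¬ T.dist c y < T.dist c x) →
      T.dist a x + T.dist c x = T.dist a c := by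
    intro a b hx hmin
    by_cases hne : x = a
    · subst hne
      simp [dist_comm]
    obtain ⟨x', hx', hd⟩ := hT.connected.exists_adj_dist_eq_add_one hne
    have hb : T.dist b x' ≤ T.dist b x + 1 := by
      have h := hT.connected.dist_triangle (u := b) (v := x) (w := x')
      rwa [dist_eq_one_iff_adj.mpr hx'] at h
    have htri := hT.connected.dist_triangle (u := a) (v := x') (w := b)
    rw [dist_comm (u := x')] at htri
    have := hmin x' (by omega)
    have hc : T.dist c x' = T.dist c x + 1 := by
      rcases hT.dist_eq_dist_add_one_of_adj c hx' with h | h <;> omega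
    have := hT.dist_eq_add_of_adj hx' hd hc
    omega
  refine ⟨x, hx, key a b hx hmin, key b a (by rw [dist_comm (u := b) (v := a)]; omega) fun y hy => ?_⟩
  exact hmin y (by rw [dist_comm (u := b) (v := a)] at hy; omega)

/-- The geodesic from `w` to `a` in a tree is linearly ordered by the distance from `w`. -/
lemma IsTree.dist_add_dist_of_dist_le (hT : T.IsTree) {w a z x : W}
    (hz : T.dist w z + T.dist a z = T.dist w a) (hx : T.dist w x + T.dist a x = T.dist w a)
    (hle : T.dist w z ≤ T.dist w x) : T.dist w z + T.dist x z = T.dist w x := by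
  obtain ⟨m, h₁, h₂, h₃⟩ := hT.exists_median w z x
  have hwm := hT.connected.dist_triangle (u := w) (v := m) (w := a)
  have haz := hT.connected.dist_triangle (u := a) (v := z) (w := m)
  have hax := hT.connected.dist_triangle (u := a) (v := x) (w := m)
  rw [dist_comm (u := m)] at hwm
  by_cases hne : m = z
  · subst hne
    exact h₂
  obtain ⟨z', hz', hd⟩ := hT.connected.exists_adj_dist_eq_add_one hne
  have hx' : T.dist x z' = T.dist x m + 1 := by
    have h := hT.connected.dist_triangle (u := z) (v := z') (w := x)
    rw [dist_comm (u := z')] at h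
    rcases hT.dist_eq_dist_add_one_of_adj x hz' with h' | h' <;> omega
  have ha : T.dist a m = T.dist a z' + 1 := by
    have h := hT.connected.dist_triangle (u := a) (v := z) (w := z')
    rcases hT.dist_eq_dist_add_one_of_adj a hz' with h' | h' <;> omega
  have := hT.dist_eq_add_of_adj hz' ha hx'
  omega

end TreeMetric

section PairCost

variable {W ι : Type*} {T : SimpleGraph W}

/-- The distance from `w` to the two attached vertices of `i`, plus the constant of `i`. -/
noncomputable def pairCost (T : SimpleGraph W) (A B : ι → W) (c : ι → ℕ) (i : ι) (w : W) : ℕ :=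
  T.dist w (A i) + c i + T.dist (B i) w

variable {A B : ι → W} {c : ι → ℕ}

/-- The index `i` maximizes the cost at `w`. -/
def PairCostMax (T : SimpleGraph W) (A B : ι → W) (c : ι → ℕ) (i : ι) (w : W) : Prop :=
  ∀ l, pairCost T A B c l w ≤ pairCost T A B c i w

lemma exists_pairCostMax [Finite ι] [Nonempty ι] (w : W) : ∃ i, PairCostMax T A B c i w :=
  Finite.exists_max fun i => pairCost T A B c i w

lemma PairCostMax.of_dist_eq (hT : T.Connected) {j : ι} {y z : W}
    (hj : PairCostMax T A B c j z) (hA : T.dist y (A j) = T.dist y z + T.dist (A j) z)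
    (hB : T.dist y (B j) = T.dist y z + T.dist (B j) z) : PairCostMax T A B c j y := by
  intro l
  have h := hj l
  have h₁ := hT.dist_triangle (u := y) (v := z) (w := A l)
  have h₂ := hT.dist_triangle (u := B l) (v := z) (w := y)
  unfold pairCost at *
  rw [dist_comm (u := B j) (v := y), dist_comm (u := y) (v := A j), dist_comm (u := A j)] at *
  rw [dist_comm (u := z) (v := y)] at h₂
  rw [dist_comm (u := A j) (v := z)] at *
  omega

/-- If `j` is optimal at `z` and both vertices of `j` lie across the edge `x z`, then `j` is
optimal at every vertex on the side of `z`. -/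
lemma PairCostMax.of_adj (hT : T.IsTree) {j : ι} {x y z : W} (hadj : T.Adj x z)
    (hj : PairCostMax T A B c j z) (hA : T.dist (A j) z = T.dist (A j) x + 1)
    (hB : T.dist (B j) z = T.dist (B j) x + 1) (hy : T.dist y x = T.dist y z + 1) :
    PairCostMax T A B c j y := by
  have h₁ := hT.dist_eq_add_of_adj hadj hy hA
  have h₂ := hT.dist_eq_add_of_adj hadj hy hB
  exact hj.of_dist_eq hT.connected (by omega) (by omega)

/-- Let `i` be optimal at a vertex `w` of the geodesic between its vertices `a` and `b`.  One
index is optimal at all vertices beyond a vertex between `w` and `a` at which `i` is not. -/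
lemma PairCostMax.exists_beyond [Finite ι] (hT : T.IsTree) {i : ι}
    {w a b : W} (hi : PairCostMax T A B c i w) (hw : T.dist a w + T.dist b w = T.dist a b)
    (hcost : ∀ y, pairCost T A B c i y = T.dist a y + T.dist b y + c i) :
    ∃ j, ∀ x y, T.dist w x + T.dist a x = T.dist w a → T.dist w x + T.dist y x = T.dist w y →
      ¬ PairCostMax T A B c i x → PairCostMax T A B c j y := by
  have : Nonempty ι := ⟨i⟩
  by_cases hex : ∃ z, T.dist w z + T.dist a z = T.dist w a ∧ ¬ PairCostMax T A B c i z
  swap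
  · exact ⟨i, fun x _ hx _ hn => absurd ⟨x, hx, hn⟩ hex⟩
  obtain ⟨z, ⟨hz, hzn⟩, hmin⟩ := (measure (T.dist w)).wf.has_min
    {z | T.dist w z + T.dist a z = T.dist w a ∧ ¬ PairCostMax T A B c i z} hex
  simp only [Set.mem_ofPred_eq, InvImage, WellFoundedRelation.rel] at hmin
  have hzw : z ≠ w := by
    rintro rfl
    exact hzn hi
  obtain ⟨v, hv, hd⟩ := hT.connected.exists_adj_dist_eq_add_one hzw
  have hvz := dist_eq_one_iff_adj.mpr hv
  have hav := hT.connected.dist_triangle (u := a) (v := z) (w := v)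
  have hwva := hT.connected.dist_triangle (u := w) (v := v) (w := a)
  rw [dist_comm (u := v)] at hwva
  have hvi : PairCostMax T A B c i v := by
    by_contra hn
    exact hmin v ⟨by omega, hn⟩ (by omega)
  obtain ⟨j, hj⟩ := exists_pairCostMax (T := T) (A := A) (B := B) (c := c) z
  have hlt : pairCost T A B c i z < pairCost T A B c j z := by
    by_contra hn
    exact hzn fun l => (hj l).trans (not_lt.mp hn)
  have hle := hvi j
  have hbz := hT.connected.dist_triangle (u := a) (v := z) (w := b)
  have hbv := hT.connected.dist_triangle (u := b) (v := w) (w := v)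
  rw [dist_comm (u := z)] at hbz
  rw [dist_comm (u := w) (v := a)] at hz hwva
  rw [hcost] at hlt hle
  unfold pairCost at hlt hle
  rw [dist_comm (v := A j)] at hlt hle
  have hA : T.dist (A j) z = T.dist (A j) v + 1 := by
    rcases hT.dist_eq_dist_add_one_of_adj (A j) hv with h | h <;>
    rcases hT.dist_eq_dist_add_one_of_adj (B j) hv with h' | h' <;> omega
  have hB : T.dist (B j) z = T.dist (B j) v + 1 := by
    rcases hT.dist_eq_dist_add_one_of_adj (B j) hv with h' | h' <;> omega
  refine ⟨j, fun x y hx hy hn => hj.of_adj hT hv.symm hA hB ?_⟩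
  have hzx := hT.dist_add_dist_of_dist_le (by rw [dist_comm (u := w) (v := a)]; exact hz) hx
    (not_lt.mp (hmin x ⟨hx, hn⟩))
  have h₁ := hT.connected.dist_triangle (u := y) (v := x) (w := z)
  have h₂ := hT.connected.dist_triangle (u := w) (v := v) (w := y)
  rw [dist_comm (u := v)] at h₂
  rcases hT.dist_eq_dist_add_one_of_adj y hv with h | h <;> omega

/-- If some index is optimal at a vertex between its two vertices, three indices cover the tree. -/
lemma PairCostMax.exists_three [Finite ι] (hT : T.IsTree) {i : ι} {w : W}
    (hi : PairCostMax T A B c i w)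
    (hw : T.dist (A i) w + T.dist (B i) w = T.dist (A i) (B i)) :
    ∃ i j k, ∀ y, PairCostMax T A B c i y ∨ PairCostMax T A B c j y ∨
      PairCostMax T A B c k y := by
  obtain ⟨j, hj⟩ := hi.exists_beyond hT hw fun y => by
    rw [pairCost, dist_comm (u := y)]; omega
  obtain ⟨k, hk⟩ := hi.exists_beyond hT (a := B i) (b := A i)
    (by rw [dist_comm (u := B i) (v := A i)]; omega) fun y => by
      rw [pairCost, dist_comm (u := y)]; omega
  refine ⟨i, j, k, fun y => ?_⟩
  obtain ⟨x, h₁, h₂, h₃⟩ := hT.exists_median (A i) (B i) y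
  by_cases hx : PairCostMax T A B c i x
  · left
    rw [dist_comm (u := A i) (v := y)] at h₂
    rw [dist_comm (u := B i) (v := y)] at h₃
    exact hx.of_dist_eq hT.connected (by omega) (by omega)
  right
  have hyw := hT.connected.dist_triangle (u := w) (v := x) (w := y)
  have hya := hT.connected.dist_triangle (u := A i) (v := w) (w := y)
  have hyb := hT.connected.dist_triangle (u := B i) (v := w) (w := y)
  have hba := hT.dist_add_dist_of_dist_le (w := A i) (a := B i) (z := x) (x := w) h₁ hw
  have hab := hT.dist_add_dist_of_dist_le (w := A i) (a := B i) (z := w) (x := x) hw h₁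
  rw [dist_comm (u := x) (v := y)] at hyw
  rw [dist_comm (u := x) (v := w)] at hab
  rcases le_total (T.dist (A i) x) (T.dist (A i) w) with h | h
  · left
    have := hba h
    exact hj x y (by rw [dist_comm (u := w) (v := A i)]; omega) (by omega) hx
  · right
    have := hab h
    exact hk x y (by rw [dist_comm (u := w) (v := B i)]; omega) (by omega) hx

/-- In a tree, three indices suffice to maximize the cost at every vertex. -/
theorem IsTree.exists_three_pairCostMax [Finite ι] [Nonempty ι] (hT : T.IsTree)
    (A B : ι → W) (c : ι → ℕ) :
    ∃ i j k, ∀ y, PairCostMax T A B c i y ∨ PairCostMax T A B c j y ∨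
      PairCostMax T A B c k y := by
  choose p hp using exists_pairCostMax (T := T) (A := A) (B := B) (c := c)
  have := hT.connected.nonempty
  obtain ⟨w, -, hmin⟩ := (measure fun w => pairCost T A B c (p w) w).wf.has_min
    Set.univ Set.univ_nonempty
  simp only [Set.mem_univ, InvImage, WellFoundedRelation.rel, true_imp_iff] at hmin
  obtain ⟨x, h₁, h₂, h₃⟩ := hT.exists_median (A (p w)) (B (p w)) w
  by_cases hxw : x = w
  · subst hxw
    exact (hp x).exists_three hT h₁
  obtain ⟨z, hz, hd⟩ := hT.connected.exists_adj_dist_eq_add_one (Ne.symm hxw)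
  have toward : ∀ a, T.dist a x + T.dist w x = T.dist a w → T.dist a w = T.dist a z + 1 := by
    intro a ha
    have h := hT.connected.dist_triangle (u := a) (v := x) (w := z)
    rw [dist_comm (u := w)] at ha
    rcases hT.dist_eq_dist_add_one_of_adj a hz with h' | h' <;> omega
  have hAw := toward _ h₂
  have hBw := toward _ h₃
  have hle := hp w (p z)
  have hge := not_lt.mp (hmin z)
  by_cases hq : PairCostMax T A B c (p z) w ∧
      T.dist (A (p z)) w + T.dist (B (p z)) w = T.dist (A (p z)) (B (p z))
  · exact hq.1.exists_three hT hq.2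
  have hcross : T.dist (A (p z)) z = T.dist (A (p z)) w + 1 ∧
      T.dist (B (p z)) z = T.dist (B (p z)) w + 1 := by
    by_contra hn
    have hAe := hT.dist_eq_dist_add_one_of_adj (A (p z)) hz
    have hBe := hT.dist_eq_dist_add_one_of_adj (B (p z)) hz
    have hle' := hle
    have hge' := hge
    unfold pairCost at hle' hge'
    rw [dist_comm (v := A (p z)), dist_comm (v := A (p w))] at hle' hge'
    refine hq ⟨fun l => (hp w l).trans (hge.trans ?_), ?_⟩
    · unfold pairCost
      rw [dist_comm (v := A (p z)), dist_comm (v := A (p z))]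
      omega
    · rcases hAe with hA | hA
      · exact (hT.dist_eq_add_of_adj hz hA (by omega)).symm
      · have := hT.dist_eq_add_of_adj hz (y := B (p z)) (by omega) hA
        rw [dist_comm (u := A (p z)) (v := B (p z))]
        omega
  refine ⟨p w, p z, p z, fun y => ?_⟩
  rcases hT.dist_eq_dist_add_one_of_adj y hz with h | h
  · exact Or.inr (Or.inl ((hp z).of_adj hT hz hcross.1 hcross.2 h))
  · exact Or.inl ((hp w).of_adj hT hz.symm hAw hBw h)

end PairCost

end SimpleGraph

lemma mem_sideOf_or_mem_sideOf {W : Type*} {T : SimpleGraph W} (hT : T.Connected) (u v t : W) :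
    t ∈ sideOf T u v u ∨ t ∈ sideOf T u v v := by
  by_contra ht
  obtain ⟨p⟩ := hT u t
  obtain ⟨d, -, h₁, h₂⟩ := p.exists_boundary_dart (sideOf T u v u ∪ sideOf T u v v)
    (Or.inl (Reachable.refl u)) ht
  by_cases he : s(d.fst, d.snd) = s(u, v)
  · rcases Sym2.eq_iff.mp he with ⟨-, h⟩ | ⟨-, h⟩
    · exact h₂ (Or.inr (h ▸ Reachable.refl _))
    · exact h₂ (Or.inl (h ▸ Reachable.refl _))
  · have hadj : (T.deleteEdges {s(u, v)}).Adj d.fst d.snd := by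
      rw [deleteEdges_adj]
      exact ⟨d.adj, he⟩
    exact h₂ (h₁.imp (fun h => Reachable.trans h hadj.reachable)
      fun h => Reachable.trans h hadj.reachable)

lemma swapSet_nonempty {W : Type*} {G T : SimpleGraph W} (hT : T.IsTree) {u v : W}
    (he : T.Adj u v) (hG : (G.deleteEdges {s(u, v)}).Connected) : (swapSet G T u v).Nonempty := by
  obtain ⟨p⟩ := hG u v
  have hv : v ∉ sideOf T u v u :=
    isBridge_iff.mp (isAcyclic_iff_forall_adj_isBridge.mp hT.isAcyclic he)
  obtain ⟨d, -, h₁, h₂⟩ := p.exists_boundary_dart (sideOf T u v u) (Reachable.refl u) hv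
  have hadj := d.adj
  rw [deleteEdges_adj] at hadj
  exact ⟨(d.fst, d.snd), hadj.1, hadj.2, h₁,
    (mem_sideOf_or_mem_sideOf hT.connected u v d.snd).resolve_left h₂⟩

/-- There are at most three pairs of swap edges such that, for every vertex `w ∈ X`, one of
the three pairs maximizes `φ_w` over `S_e × S_e`. -/
theorem three_pairs_suffice
    (G T : SimpleGraph V) (hTG : T ≤ G) (hT : T.IsTree)
    (hGconn : G.Connected) (h2ec : ∀ f ∈ G.edgeSet, (G.deleteEdges {f}).Connected)
    (u v : V) (he : T.Adj u v) :
    ∃ p₁ p₂ p₃ : (V × V) × (V × V),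
      p₁.1 ∈ swapSet G T u v ∧ p₁.2 ∈ swapSet G T u v ∧
      p₂.1 ∈ swapSet G T u v ∧ p₂.2 ∈ swapSet G T u v ∧
      p₃.1 ∈ swapSet G T u v ∧ p₃.2 ∈ swapSet G T u v ∧
      ∀ w ∈ sideOf T u v u,
        (∀ g ∈ swapSet G T u v, ∀ g' ∈ swapSet G T u v,
            phi T w g g' ≤ phi T w p₁.1 p₁.2) ∨
        (∀ g ∈ swapSet G T u v, ∀ g' ∈ swapSet G T u v,
            phi T w g g' ≤ phi T w p₂.1 p₂.2) ∨
        (∀ g ∈ swapSet G T u v, ∀ g' ∈ swapSet G T u v,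
            phi T w g g' ≤ phi T w p₃.1 p₃.2) := by
  have hG := h2ec s(u, v) (hTG he)
  obtain ⟨g₀, hg₀⟩ := swapSet_nonempty hT he hG
  let S := swapSet G T u v
  have : Nonempty (S × S) := ⟨⟨g₀, hg₀⟩, ⟨g₀, hg₀⟩⟩
  obtain ⟨i, j, k, h⟩ := hT.exists_three_pairCostMax
    (fun p : S × S => p.1.1.1) (fun p => p.2.1.1) (fun p => T.dist p.1.1.2 p.2.1.2)
  refine ⟨(i.1, i.2), (j.1, j.2), (k.1, k.2), i.1.2, i.2.2, j.1.2, j.2.2, k.1.2, k.2.2,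
    fun w _ => ?_⟩
  exact (h w).imp (fun h g hg g' hg' => h (⟨g, hg⟩, ⟨g', hg'⟩))
    (Or.imp (fun h g hg g' hg' => h (⟨g, hg⟩, ⟨g', hg'⟩))
      fun h g hg g' hg' => h (⟨g, hg⟩, ⟨g', hg'⟩))
end

section
/- Let e'=(x,z) be an edge of T_X, and suppose a_x, a_z ∈ U(e',x) and a'_x, a'_z ∈ U(e',z). Then φ_z(g_x,g'_x) = φ_z(g_z,g'_z); in particular, it is impossible that φ_z(g_x,g'_x) < φ_z(g_z,g'_z). -/
open SimpleGraph

variable {V : Type*} [Fintype V] [DecidableEq V]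

/-- In a tree, if `a` lies on the side of `x` of the edge `(x, z)`, then `a` is one step further
from `z` than from `x`. -/
theorem SimpleGraph.IsTree.dist_eq_dist_add_one_of_reachable_deleteEdges
    {W : Type*} {T : SimpleGraph W} (hT : T.IsTree) {x z a : W} (hxz : T.Adj x z)
    (ha : (T.deleteEdges {s(x, z)}).Reachable x a) : T.dist z a = T.dist x a + 1 := by
  classical
  have hadj := hT.dist_eq_dist_add_one_of_adj a hxz
  rw [T.dist_comm (u := a), T.dist_comm (u := a)] at hadj
  refine hadj.resolve_left fun h => ?_
  obtain ⟨p, hp⟩ := hT.connected.exists_walk_length_eq_dist z a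
  have hnot : s(x, z) ∉ p.edges := fun hmem => by
    have hx := p.fst_mem_support_of_mem_edges hmem
    have h1 := dist_le (p.dropUntil x hx)
    have h2 := p.length_dropUntil_le_length hx
    omega
  have hbridge := isAcyclic_iff_forall_adj_isBridge.mp hT.isAcyclic hxz
  exact isBridge_iff.mp hbridge
    (ha.trans (reachable_deleteEdges_iff_exists_walk.mpr ⟨p, hnot⟩).symm)

/-- If `e' = (x, z)` is an edge of `T_X` with `a_x, a_z ∈ U(e', x)` and
`a'_x, a'_z ∈ U(e', z)`, then `φ_z(g_x, g'_x) = φ_z(g_z, g'_z)`; in particular it is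
impossible that `φ_z(g_x, g'_x) < φ_z(g_z, g'_z)`. -/
theorem no_split_case
    (G T : SimpleGraph V) (hTG : T ≤ G) (hT : T.IsTree)
    (hGconn : G.Connected) (h2ec : ∀ f ∈ G.edgeSet, (G.deleteEdges {f}).Connected)
    (u v : V) (he : T.Adj u v)
    (gp : V → (V × V) × (V × V))
    (hgp : ∀ w ∈ sideOf T u v u,
      (gp w).1 ∈ swapSet G T u v ∧ (gp w).2 ∈ swapSet G T u v ∧
        ∀ g ∈ swapSet G T u v, ∀ g' ∈ swapSet G T u v,
          phi T w g g' ≤ phi T w (gp w).1 (gp w).2)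
    (x z : V) (hx : x ∈ sideOf T u v u) (hz : z ∈ sideOf T u v u) (hxz : T.Adj x z)
    (hax : (gp x).1.1 ∈ Uside T (sideOf T u v u) x z)
    (haz : (gp z).1.1 ∈ Uside T (sideOf T u v u) x z)
    (hax' : (gp x).2.1 ∈ Uside T (sideOf T u v u) z x)
    (haz' : (gp z).2.1 ∈ Uside T (sideOf T u v u) z x) :
    phi T z (gp x).1 (gp x).2 = phi T z (gp z).1 (gp z).2 ∧
      ¬ phi T z (gp x).1 (gp x).2 < phi T z (gp z).1 (gp z).2 := by
  have hzx : ∀ a ∈ Uside T (sideOf T u v u) x z, T.dist z a = T.dist x a + 1 :=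
    fun a ha => hT.dist_eq_dist_add_one_of_reachable_deleteEdges hxz ha.2
  have hxz' : ∀ a ∈ Uside T (sideOf T u v u) z x, T.dist x a = T.dist z a + 1 :=
    fun a ha => hT.dist_eq_dist_add_one_of_reachable_deleteEdges hxz.symm ha.2
  have phi_eq : ∀ g g' : V × V, g.1 ∈ Uside T (sideOf T u v u) x z →
      g'.1 ∈ Uside T (sideOf T u v u) z x → phi T x g g' = phi T z g g' := by
    intro g g' hg hg'
    have h := hzx _ hg
    have h' := hxz' _ hg'
    simp only [phi, T.dist_comm (u := g'.1)]
    omega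
  obtain ⟨hgx, hgx', hmax_x⟩ := hgp x hx
  obtain ⟨hgz, hgz', hmax_z⟩ := hgp z hz
  have hle := hmax_z _ hgx _ hgx'
  have hge := hmax_x _ hgz _ hgz'
  rw [phi_eq _ _ hax hax', phi_eq _ _ haz haz'] at hge
  exact ⟨le_antisymm hle hge, hge.not_gt⟩
end

section
/- Let e'=(x,z) be an edge of T_X, and suppose both a_x ∈ U(e',x) and a'_x ∈ U(e',x). Then φ_z(g_x,g'_x) = φ_z(g_z,g'_z); in particular, it is impossible that φ_z(g_x,g'_x) < φ_z(g_z,g'_z). -/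
open SimpleGraph

variable {V : Type*} [Fintype V] [DecidableEq V]

/-- Removing the tree edge `s(x, z)` separates `z` from every vertex `a` that stays connected
to `x`, so the shortest path from `z` to `a` runs through `x`. -/
theorem dist_succ_le_of_reachable_deleteEdges {W : Type*} {T : SimpleGraph W} (hT : T.IsTree)
    {x z a : W} (hxz : T.Adj x z) (ha : (T.deleteEdges {s(x, z)}).Reachable x a) :
    T.dist x a + 1 ≤ T.dist z a := by
  classical
  have hbridge : ¬ (T.deleteEdges {s(x, z)}).Reachable x z :=
    isBridge_iff.mp (isAcyclic_iff_forall_adj_isBridge.mp hT.isAcyclic hxz)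
  obtain ⟨p, hp⟩ := hT.connected.exists_walk_length_eq_dist z a
  have hmem : s(x, z) ∈ p.edges := by
    by_contra h
    exact hbridge (ha.trans (p.toDeleteEdge _ h).reachable.symm)
  have hxp : x ∈ p.support := p.fst_mem_support_of_mem_edges hmem
  have hlen := congrArg Walk.length (p.take_spec hxp)
  rw [Walk.length_append] at hlen
  have hzx : T.dist z x ≤ (p.takeUntil x hxp).length := dist_le _
  have hxa : T.dist x a ≤ (p.dropUntil x hxp).length := dist_le _
  have hone : T.dist z x = 1 := dist_eq_one_iff_adj.mpr hxz.symm
  omega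

/-- If `e' = (x, z)` is an edge of `T_X` with `a_x, a'_x ∈ U(e', x)`, then
`φ_z(g_x, g'_x) = φ_z(g_z, g'_z)`; in particular it is impossible that
`φ_z(g_x, g'_x) < φ_z(g_z, g'_z)`. -/
theorem both_on_x_side
    (G T : SimpleGraph V) (hTG : T ≤ G) (hT : T.IsTree)
    (hGconn : G.Connected) (h2ec : ∀ f ∈ G.edgeSet, (G.deleteEdges {f}).Connected)
    (u v : V) (he : T.Adj u v)
    (gp : V → (V × V) × (V × V))
    (hgp : ∀ w ∈ sideOf T u v u,
      (gp w).1 ∈ swapSet G T u v ∧ (gp w).2 ∈ swapSet G T u v ∧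
        ∀ g ∈ swapSet G T u v, ∀ g' ∈ swapSet G T u v,
          phi T w g g' ≤ phi T w (gp w).1 (gp w).2)
    (x z : V) (hx : x ∈ sideOf T u v u) (hz : z ∈ sideOf T u v u) (hxz : T.Adj x z)
    (hax : (gp x).1.1 ∈ Uside T (sideOf T u v u) x z)
    (hax' : (gp x).2.1 ∈ Uside T (sideOf T u v u) x z) :
    phi T z (gp x).1 (gp x).2 = phi T z (gp z).1 (gp z).2 ∧
      ¬ phi T z (gp x).1 (gp x).2 < phi T z (gp z).1 (gp z).2 := by
  obtain ⟨hgx, hgx', hmaxx⟩ := hgp x hx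
  obtain ⟨hgz, hgz', hmaxz⟩ := hgp z hz
  have hle := hmaxz _ hgx _ hgx'
  have hge := hmaxx _ hgz _ hgz'
  have h₁ := dist_succ_le_of_reachable_deleteEdges hT hxz hax.2
  have h₂ := dist_succ_le_of_reachable_deleteEdges hT hxz hax'.2
  have hone : T.dist z x = 1 := dist_eq_one_iff_adj.mpr hxz.symm
  have t₁ : T.dist z (gp z).1.1 ≤ T.dist z x + T.dist x (gp z).1.1 :=
    hT.connected.dist_triangle
  have t₂ : T.dist z (gp z).2.1 ≤ T.dist z x + T.dist x (gp z).2.1 :=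
    hT.connected.dist_triangle
  unfold phi at *
  rw [T.dist_comm (u := (gp x).2.1), T.dist_comm (u := (gp z).2.1)] at hle hge ⊢
  omega
end

section
/- Let e'=(x,z) be an edge of T_X such that φ_z(g_x,g'_x) < φ_z(g_z,g'_z). Then it is not the case that both a_z ∈ U(e',z) and a'_z ∈ U(e',z); equivalently, {a_z, a'_z} ∩ U(e',x) ≠ ∅. -/
open SimpleGraph

variable {V : Type*} [Fintype V] [DecidableEq V]

namespace SimpleGraph

variable {W : Type*} {H : SimpleGraph W} {x z t : W}

/-- After removing one edge of a graph, every vertex that was connected to one of its endpoints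
is still connected to one of the endpoints. -/
lemma Reachable.deleteEdges_or (h : H.Reachable t x) :
    (H.deleteEdges {s(x, z)}).Reachable x t ∨ (H.deleteEdges {s(x, z)}).Reachable z t := by
  obtain ⟨p⟩ := h
  induction p with
  | nil => exact Or.inl .rfl
  | @cons t t' x hadj p ih =>
    by_cases hst : s(t, t') = s(x, z)
    · rcases Sym2.eq_iff.1 hst with ⟨rfl, -⟩ | ⟨rfl, -⟩
      · exact Or.inl .rfl
      · exact Or.inr .rfl
    · have hstep : (H.deleteEdges {s(x, z)}).Reachable t' t :=
        (deleteEdges_adj.2 ⟨hadj, hst⟩).reachable.symm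
      exact ih.imp (·.trans hstep) (·.trans hstep)

/-- In a tree, crossing an edge away from the side of `t` increases the distance to `t`. -/
lemma IsTree.dist_add_one_le (hH : H.IsTree) (hxz : H.Adj x z)
    (ht : (H.deleteEdges {s(x, z)}).Reachable z t) : H.dist z t + 1 ≤ H.dist x t := by
  classical
  have hxt : ¬ (H.deleteEdges {s(x, z)}).Reachable x t := fun h =>
    isBridge_iff.1 (isAcyclic_iff_forall_adj_isBridge.1 hH.isAcyclic hxz) (h.trans ht.symm)
  obtain ⟨p, hp⟩ := hH.connected.exists_walk_length_eq_dist x t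
  have hzp : z ∈ p.support :=
    p.snd_mem_support_of_mem_edges (p.mem_edges_of_not_reachable_deleteEdges hxt)
  have hlen := congrArg Walk.length (p.take_spec hzp)
  rw [Walk.length_append] at hlen
  have h1 := dist_le (p.takeUntil z hzp)
  have h2 := dist_le (p.dropUntil z hzp)
  have h3 := dist_eq_one_iff_adj.2 hxz
  omega

end SimpleGraph

/-- If `e' = (x, z)` is an edge of `T_X` with `φ_z(g_x, g'_x) < φ_z(g_z, g'_z)`, then it is
not the case that both `a_z ∈ U(e', z)` and `a'_z ∈ U(e', z)`; equivalently
`{a_z, a'_z} ∩ U(e', x) ≠ ∅`. -/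
theorem not_both_on_z_side
    (G T : SimpleGraph V) (hTG : T ≤ G) (hT : T.IsTree)
    (hGconn : G.Connected) (h2ec : ∀ f ∈ G.edgeSet, (G.deleteEdges {f}).Connected)
    (u v : V) (he : T.Adj u v)
    (gp : V → (V × V) × (V × V))
    (hgp : ∀ w ∈ sideOf T u v u,
      (gp w).1 ∈ swapSet G T u v ∧ (gp w).2 ∈ swapSet G T u v ∧
        ∀ g ∈ swapSet G T u v, ∀ g' ∈ swapSet G T u v,
          phi T w g g' ≤ phi T w (gp w).1 (gp w).2)
    (x z : V) (hx : x ∈ sideOf T u v u) (hz : z ∈ sideOf T u v u) (hxz : T.Adj x z)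
    (hlt : phi T z (gp x).1 (gp x).2 < phi T z (gp z).1 (gp z).2) :
    ¬ ((gp z).1.1 ∈ Uside T (sideOf T u v u) z x ∧
        (gp z).2.1 ∈ Uside T (sideOf T u v u) z x) ∧
      ((gp z).1.1 ∈ Uside T (sideOf T u v u) x z ∨
        (gp z).2.1 ∈ Uside T (sideOf T u v u) x z) := by
  obtain ⟨hz1, hz2, -⟩ := hgp z hz
  have key : ¬ ((T.deleteEdges {s(x, z)}).Reachable z (gp z).1.1 ∧
      (T.deleteEdges {s(x, z)}).Reachable z (gp z).2.1) := by
    rintro ⟨h1, h2⟩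
    have hmax := (hgp x hx).2.2 _ hz1 _ hz2
    have ha := hT.dist_add_one_le hxz h1
    have ha' := hT.dist_add_one_le hxz h2
    have hd : T.dist x z = 1 := dist_eq_one_iff_adj.2 hxz
    have hb := hT.connected.dist_triangle (u := x) (v := z) (w := (gp x).1.1)
    have hb' := hT.connected.dist_triangle (u := x) (v := z) (w := (gp x).2.1)
    simp only [phi, T.dist_comm (u := (gp x).2.1), T.dist_comm (u := (gp z).2.1)] at hlt hmax
    omega
  refine ⟨fun ⟨h1, h2⟩ => key ?_, ?_⟩
  · rw [Sym2.eq_swap]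
    exact ⟨h1.2, h2.2⟩
  · by_contra! hnot
    refine key ⟨?_, ?_⟩
    · exact (hT.connected (gp z).1.1 x).deleteEdges_or.resolve_left
        fun h => hnot.1 ⟨hz1.2.2.1, h⟩
    · exact (hT.connected (gp z).2.1 x).deleteEdges_or.resolve_left
        fun h => hnot.2 ⟨hz2.2.2.1, h⟩
end

section
/- Let e'=(x,z) be an edge of T_X and suppose a_z, a'_z ∈ U(e',x). Then for every vertex z' ∈ U(e',z), the pair (g_z,g'_z) maximizes φ_{z'}, i.e., φ_{z'}(g_z,g'_z) = φ_{z'}(g_{z'},g'_{z'}) = max_{(g,g') ∈ S_e × S_e} φ_{z'}(g,g'). -/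
open SimpleGraph

variable {V : Type*} [Fintype V] [DecidableEq V]

/-- If deleting the edge `s(x, z)` of a tree separates `w` (on the side of `z`) from `a`
(on the side of `x`), then the path from `w` to `a` passes through `z`. -/
theorem SimpleGraph.IsTree.dist_eq_add_of_separated {V : Type*} {T : SimpleGraph V}
    (hT : T.IsTree) {x z w a : V} (hxz : T.Adj x z)
    (hw : (T.deleteEdges {s(x, z)}).Reachable z w)
    (ha : (T.deleteEdges {s(x, z)}).Reachable x a) :
    T.dist w a = T.dist w z + T.dist z a := by
  classical
  refine le_antisymm hT.connected.dist_triangle ?_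
  obtain ⟨p, hp⟩ := hT.connected.exists_walk_length_eq_dist w a
  have hz : z ∈ p.support := by
    by_contra hz
    have hbridge : T.IsBridge s(x, z) :=
      isAcyclic_iff_forall_adj_isBridge.mp hT.isAcyclic hxz
    have hwa : (T.deleteEdges {s(x, z)}).Reachable w a :=
      ⟨p.toDeleteEdge s(x, z) fun h => hz (p.snd_mem_support_of_mem_edges h)⟩
    exact (isBridge_iff.mp hbridge) (ha.trans (hwa.symm.trans hw.symm))
  have hlen := congrArg Walk.length (p.take_spec hz)
  rw [Walk.length_append, hp] at hlen
  exact hlen ▸ add_le_add (dist_le _) (dist_le _)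

/-- If `e' = (x, z)` is an edge of `T_X` with `a_z, a'_z ∈ U(e', x)`, then for every
`z' ∈ U(e', z)` the pair `(g_z, g'_z)` maximizes `φ_{z'}`:
`φ_{z'}(g_z, g'_z) = φ_{z'}(g_{z'}, g'_{z'}) = max_{(g, g')} φ_{z'}(g, g')`. -/
theorem maximizer_propagates
    (G T : SimpleGraph V) (hTG : T ≤ G) (hT : T.IsTree)
    (hGconn : G.Connected) (h2ec : ∀ f ∈ G.edgeSet, (G.deleteEdges {f}).Connected)
    (u v : V) (he : T.Adj u v)
    (gp : V → (V × V) × (V × V))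
    (hgp : ∀ w ∈ sideOf T u v u,
      (gp w).1 ∈ swapSet G T u v ∧ (gp w).2 ∈ swapSet G T u v ∧
        ∀ g ∈ swapSet G T u v, ∀ g' ∈ swapSet G T u v,
          phi T w g g' ≤ phi T w (gp w).1 (gp w).2)
    (x z : V) (hx : x ∈ sideOf T u v u) (hz : z ∈ sideOf T u v u) (hxz : T.Adj x z)
    (haz : (gp z).1.1 ∈ Uside T (sideOf T u v u) x z)
    (haz' : (gp z).2.1 ∈ Uside T (sideOf T u v u) x z) :
    ∀ z' ∈ Uside T (sideOf T u v u) z x,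
      phi T z' (gp z).1 (gp z).2 = phi T z' (gp z').1 (gp z').2 ∧
        ∀ g ∈ swapSet G T u v, ∀ g' ∈ swapSet G T u v,
          phi T z' g g' ≤ phi T z' (gp z).1 (gp z).2 := by
  intro z' hz'
  obtain ⟨hz'X, hz'z⟩ := hz'
  rw [Sym2.eq_swap] at hz'z
  have key : ∀ g ∈ swapSet G T u v, ∀ g' ∈ swapSet G T u v,
      phi T z' g g' ≤ phi T z' (gp z).1 (gp z).2 := by
    intro g hg g' hg'
    have hmax := (hgp z hz).2.2 g hg g' hg'
    have h₁ := hT.dist_eq_add_of_separated hxz hz'z haz.2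
    have h₂ := hT.dist_eq_add_of_separated hxz hz'z haz'.2
    have h₃ : T.dist z' g.1 ≤ T.dist z' z + T.dist z g.1 := hT.connected.dist_triangle
    have h₄ : T.dist z' g'.1 ≤ T.dist z' z + T.dist z g'.1 := hT.connected.dist_triangle
    simp only [phi, T.dist_comm (u := g'.1), T.dist_comm (u := (gp z).2.1)] at hmax ⊢
    omega
  obtain ⟨hg, hg', hmax⟩ := hgp z' hz'X
  exact ⟨le_antisymm (hmax _ (hgp z hz).1 _ (hgp z hz).2.1) (key _ hg _ hg'), key⟩
end
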